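/- Let b = k ∈ ℤ. Then for every generator u ∈ {E11(n), E12(n), E21(n), E22(n) : n ∈ ℤ²} ∪ {D1, D2}, the b-twisted operator ũ on N equals X_m^{k} ∘ u ∘ X_m^{−k}; consequently the bijection v ↦ x_m^{k}·v of N intertwines the untwisted operators with the b-twisted operators, i.e. the twisted module 𝒟_m^b M is isomorphic to 𝒟_m M. -/

import Mathlib

open MvPolynomial Finsupp

/-- The index set of the variables other than `x_m`. -/
abbrev NVar (m : ℤ × ℤ) := {p : ℤ × ℤ // p ≠ m}

/-- `N = ℂ[x_m, x_m^{−1}][x_n : n ≠ m]`, realized as finitely supported families,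
indexed by the exponent of `x_m` (an arbitrary integer), of polynomials in the
variables `x_n`, `n ≠ m`. -/
abbrev NN (m : ℤ × ℤ) := ℤ →₀ MvPolynomial (NVar m) ℂ

/-- Multiplication by `x_m^j` on `N` (for `j = -1` this is `X_m^{−1}`). -/
noncomputable def XmZ (m : ℤ × ℤ) (j : ℤ) (g : NN m) : NN m :=
  Finsupp.mapDomain (· + j) g

/-- Multiplication by `x_k` on `N` (the operator `X_k`). -/
noncomputable def Xop (m : ℤ × ℤ) (k : ℤ × ℤ) (g : NN m) : NN m :=
  if h : k = m then XmZ m 1 g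
  else Finsupp.mapRange (fun a => X (⟨k, h⟩ : NVar m) * a) (by simp) g

/-- The partial derivative `∂_s` on `N` (with `∂_m x_m^k = k x_m^{k−1}`, `k ∈ ℤ`). -/
noncomputable def Dop (m : ℤ × ℤ) (s : ℤ × ℤ) (g : NN m) : NN m :=
  if h : s = m then g.sum (fun k a => Finsupp.single (k - 1) (k • a))
  else Finsupp.mapRange (fun a => pderiv (⟨s, h⟩ : NVar m) a) (by simp) g

/-- A finite set of indices containing every `s` for which `∂_s` acts nonzero on `g`
(together with `m`); sums over all `s ∈ ℤ²` in the defining formulas reduce to sums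
over this finite set. -/
noncomputable def nvars (m : ℤ × ℤ) (g : NN m) : Finset (ℤ × ℤ) :=
  insert m (g.support.biUnion fun k => (g k).vars.image Subtype.val)

/-- `E21(n)` on `N`: multiplication by `x_n`. -/
noncomputable def E21N (m n : ℤ × ℤ) (g : NN m) : NN m := Xop m n g

/-- `E22(n) = Σ_s q^{s₁n₂} x_{n+s} ∂_s` on `N`. -/
noncomputable def E22N (q : ℂ) (m n : ℤ × ℤ) (g : NN m) : NN m :=
  ∑ s ∈ nvars m g, q ^ (s.1 * n.2) • Xop m (n + s) (Dop m s g)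

/-- `E11(n) = δ_{n,0} μ id − Σ_s q^{s₂n₁} x_{n+s} ∂_s` on `N`. -/
noncomputable def E11N (q μ : ℂ) (m n : ℤ × ℤ) (g : NN m) : NN m :=
  (if n = 0 then μ • g else 0) - ∑ s ∈ nvars m g, q ^ (s.2 * n.1) • Xop m (n + s) (Dop m s g)

/-- `E12(n) = q^{−n₁n₂} μ ∂_{−n} − Σ_{s,r} q^{n₂r₁+s₂n₁+s₂r₁} x_{n+s+r} ∂_s ∂_r` on `N`. -/
noncomputable def E12N (q μ : ℂ) (m n : ℤ × ℤ) (g : NN m) : NN m :=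
  q ^ (-(n.1 * n.2)) • μ • Dop m (-n) g -
    ∑ s ∈ nvars m g, ∑ r ∈ nvars m g,
      q ^ (n.2 * r.1 + s.2 * n.1 + s.2 * r.1) • Xop m (n + s + r) (Dop m s (Dop m r g))

/-- `𝓔_m = Σ_{s,r} q^{−m₂r₁−s₂m₁+s₂r₁} x_{−m+s+r} ∂_s ∂_r` on `N`. -/
noncomputable def EmN (q : ℂ) (m : ℤ × ℤ) (g : NN m) : NN m :=
  ∑ s ∈ nvars m g, ∑ r ∈ nvars m g,
    q ^ (-(m.2 * r.1) - s.2 * m.1 + s.2 * r.1) • Xop m (-m + s + r) (Dop m s (Dop m r g))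

/-- `D1 = Σ_s s₁ x_s ∂_s` on `N`. -/
noncomputable def D1N (m : ℤ × ℤ) (g : NN m) : NN m :=
  ∑ s ∈ nvars m g, (s.1 : ℂ) • Xop m s (Dop m s g)

/-- `D2 = Σ_s s₂ x_s ∂_s` on `N`. -/
noncomputable def D2N (m : ℤ × ℤ) (g : NN m) : NN m :=
  ∑ s ∈ nvars m g, (s.2 : ℂ) • Xop m s (Dop m s g)

/-- The `b`-twisted operator `Ẽ12(n)` on `N`. -/
noncomputable def tE12 (q μ : ℂ) (m : ℤ × ℤ) (b : ℂ) (n : ℤ × ℤ) (g : NN m) : NN m :=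
  E12N q μ m n g
    + b • (q ^ (m.2 * n.1) • E22N q m (m + n) (XmZ m (-1) g)
           - q ^ (m.1 * n.2) • E11N q μ m (m + n) (XmZ m (-1) g))
    - (b * (b - 1) * q ^ (m.2 * n.1 + m.2 * m.1 + m.1 * n.2)) •
        Xop m (m + m + n) (XmZ m (-1) (XmZ m (-1) g))

/-- The `b`-twisted operator `Ẽ11(n)` on `N`. -/
noncomputable def tE11 (q μ : ℂ) (m : ℤ × ℤ) (b : ℂ) (n : ℤ × ℤ) (g : NN m) : NN m :=
  E11N q μ m n g + (b * q ^ (m.2 * n.1)) • Xop m (m + n) (XmZ m (-1) g)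

/-- The `b`-twisted operator `Ẽ22(n)` on `N`. -/
noncomputable def tE22 (q : ℂ) (m : ℤ × ℤ) (b : ℂ) (n : ℤ × ℤ) (g : NN m) : NN m :=
  E22N q m n g - (b * q ^ (m.1 * n.2)) • Xop m (m + n) (XmZ m (-1) g)

/-- The `b`-twisted operator `D̃1 = D1 − b m₁ id` on `N`. -/
noncomputable def tD1 (m : ℤ × ℤ) (b : ℂ) (g : NN m) : NN m := D1N m g - (b * (m.1 : ℂ)) • g

/-- The `b`-twisted operator `D̃2 = D2 − b m₂ id` on `N`. -/
noncomputable def tD2 (m : ℤ × ℤ) (b : ℂ) (g : NN m) : NN m := D2N m g - (b * (m.2 : ℂ)) • g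

theorem XmZ_apply (m : ℤ × ℤ) (j : ℤ) (g : NN m) (i : ℤ) : XmZ m j g i = g (i - j) := by
  have h := Finsupp.mapDomain_apply (add_left_injective j) g (i - j)
  simpa [XmZ] using h

theorem Xop_self_apply (m : ℤ × ℤ) (g : NN m) (i : ℤ) : Xop m m g i = g (i - 1) := by
  simp [Xop, XmZ_apply]

theorem Xop_apply_of_ne {m k : ℤ × ℤ} (h : k ≠ m) (g : NN m) (i : ℤ) :
    Xop m k g i = X (⟨k, h⟩ : NVar m) * g i := by
  simp [Xop, h]

theorem Dop_self_apply (m : ℤ × ℤ) (g : NN m) (i : ℤ) :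
    Dop m m g i = (i + 1) • g (i + 1) := by
  simp only [Dop, dite_true, Finsupp.sum_apply]
  rw [Finsupp.sum, Finset.sum_eq_single (i + 1)]
  · simp
  · intro b _ hb
    rw [Finsupp.single_eq_of_ne]
    omega
  · intro h
    simp [Finsupp.notMem_support_iff.mp h]

theorem Dop_apply_of_ne {m s : ℤ × ℤ} (h : s ≠ m) (g : NN m) (i : ℤ) :
    Dop m s g i = pderiv (⟨s, h⟩ : NVar m) (g i) := by
  simp [Dop, h]

/-- `XmZ m j` as a linear map. -/
noncomputable def XmZLin (m : ℤ × ℤ) (j : ℤ) : NN m →ₗ[ℂ] NN m where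
  toFun := XmZ m j
  map_add' f g := by ext1 i; simp [XmZ_apply]
  map_smul' c g := by ext1 i; simp [XmZ_apply]

/-- `Xop m k` as a linear map. -/
noncomputable def XopLin (m k : ℤ × ℤ) : NN m →ₗ[ℂ] NN m where
  toFun := Xop m k
  map_add' f g := by
    ext1 i
    by_cases h : k = m
    · subst h; simp [Xop_self_apply]
    · simp [Xop_apply_of_ne h, mul_add]
  map_smul' c g := by
    ext1 i
    by_cases h : k = m
    · subst h; simp [Xop_self_apply]
    · simp [Xop_apply_of_ne h]

/-- `Dop m s` as a linear map. -/
noncomputable def DopLin (m s : ℤ × ℤ) : NN m →ₗ[ℂ] NN m where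
  toFun := Dop m s
  map_add' f g := by
    ext1 i
    by_cases h : s = m
    · subst h; simp [Dop_self_apply]
    · simp [Dop_apply_of_ne h]
  map_smul' c g := by
    ext1 i
    by_cases h : s = m
    · subst h; simp [Dop_self_apply]
    · simp [Dop_apply_of_ne h]

theorem XmZ_eq_lin (m : ℤ × ℤ) (j : ℤ) (g : NN m) : XmZ m j g = XmZLin m j g := rfl

theorem Xop_eq_lin (m k : ℤ × ℤ) (g : NN m) : Xop m k g = XopLin m k g := rfl

theorem Dop_eq_lin (m s : ℤ × ℤ) (g : NN m) : Dop m s g = DopLin m s g := rfl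

theorem XmZLin_XmZLin (m : ℤ × ℤ) (i j : ℤ) (g : NN m) :
    XmZLin m i (XmZLin m j g) = XmZLin m (i + j) g := by
  ext1 l
  simp only [← XmZ_eq_lin, XmZ_apply, sub_sub]

theorem XmZLin_zero (m : ℤ × ℤ) (g : NN m) : XmZLin m 0 g = g := by
  ext1 l
  simp only [← XmZ_eq_lin, XmZ_apply, sub_zero]

theorem XmZ_XmZ_neg (m : ℤ × ℤ) (k : ℤ) (g : NN m) : XmZ m k (XmZ m (-k) g) = g := by
  simp [XmZ_eq_lin, XmZLin_XmZLin, XmZLin_zero]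

theorem XopLin_XmZLin (m n : ℤ × ℤ) (j : ℤ) (g : NN m) :
    XopLin m n (XmZLin m j g) = XmZLin m j (XopLin m n g) := by
  ext1 l
  simp only [← XmZ_eq_lin, ← Xop_eq_lin]
  by_cases h : n = m
  · subst h; simp [Xop_self_apply, XmZ_apply, sub_right_comm]
  · simp [Xop_apply_of_ne h, XmZ_apply]

theorem XopLin_self (m : ℤ × ℤ) (g : NN m) : XopLin m m g = XmZLin m 1 g := by
  ext1 l
  simp only [← XmZ_eq_lin, ← Xop_eq_lin, Xop_self_apply, XmZ_apply]

/-- The Leibniz rule for `∂_s` and multiplication by `x_m^j`. -/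
theorem DopLin_XmZLin (m s : ℤ × ℤ) (j : ℤ) (g : NN m) :
    DopLin m s (XmZLin m j g) =
      XmZLin m j (DopLin m s g) + if s = m then (j : ℂ) • XmZLin m (j - 1) g else 0 := by
  ext1 l
  simp only [← XmZ_eq_lin, ← Dop_eq_lin]
  by_cases h : s = m
  · subst h
    simp only [if_true, Finsupp.add_apply, Finsupp.smul_apply, Dop_self_apply, XmZ_apply]
    rw [show l - (j - 1) = l - j + 1 by ring, show l + 1 - j = l - j + 1 by ring,
      Int.cast_smul_eq_zsmul, ← add_smul]
    congr 1
    ring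
  · simp [Dop_apply_of_ne h, XmZ_apply, h]

theorem mem_nvars_self (m : ℤ × ℤ) (g : NN m) : m ∈ nvars m g :=
  Finset.mem_insert_self _ _

theorem nvars_XmZLin (m : ℤ × ℤ) (j : ℤ) (g : NN m) : nvars m (XmZLin m j g) = nvars m g := by
  ext s
  simp only [nvars, Finset.mem_insert, Finset.mem_biUnion, Finsupp.mem_support_iff,
    ← XmZ_eq_lin, XmZ_apply]
  refine or_congr_right ⟨?_, ?_⟩
  · rintro ⟨i, hi⟩
    exact ⟨i - j, hi⟩
  · rintro ⟨i, hi⟩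
    exact ⟨i + j, by simpa using hi⟩

/-- The first-order sums `Σ_s c_s x_{f s} ∂_s` conjugated by `x_m^j`. -/
theorem sum_Xop_Dop_XmZ (m : ℤ × ℤ) (c : ℤ × ℤ → ℂ) (f : ℤ × ℤ → ℤ × ℤ) (j : ℤ) (v : NN m) :
    ∑ s ∈ nvars m v, c s • XopLin m (f s) (DopLin m s (XmZLin m j v)) =
      XmZLin m j (∑ s ∈ nvars m v, c s • XopLin m (f s) (DopLin m s v)) +
        ((j : ℂ) * c m) • XmZLin m (j - 1) (XopLin m (f m) v) := by
  simp only [DopLin_XmZLin, map_add, smul_add, Finset.sum_add_distrib, map_sum, map_smul,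
    XopLin_XmZLin]
  congr 1
  rw [Finset.sum_eq_single_of_mem m (mem_nvars_self m v)]
  · simp [XopLin_XmZLin, smul_smul, mul_comm]
  · intro s _ hs
    simp [hs]

/-- The second-order sums `Σ_{s,r} c_{s,r} x_{f s r} ∂_s ∂_r` conjugated by `x_m^j`. -/
theorem sum_Xop_Dop_Dop_XmZ (m : ℤ × ℤ) (c : ℤ × ℤ → ℤ × ℤ → ℂ)
    (f : ℤ × ℤ → ℤ × ℤ → ℤ × ℤ) (j : ℤ) (v : NN m) :
    ∑ s ∈ nvars m v, ∑ r ∈ nvars m v,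
        c s r • XopLin m (f s r) (DopLin m s (DopLin m r (XmZLin m j v))) =
      XmZLin m j (∑ s ∈ nvars m v, ∑ r ∈ nvars m v,
        c s r • XopLin m (f s r) (DopLin m s (DopLin m r v))) +
      (j : ℂ) • XmZLin m (j - 1)
        (∑ r ∈ nvars m v, c m r • XopLin m (f m r) (DopLin m r v)) +
      (j : ℂ) • XmZLin m (j - 1)
        (∑ s ∈ nvars m v, c s m • XopLin m (f s m) (DopLin m s v)) +
      ((j : ℂ) * (j - 1) * c m m) • XmZLin m (j - 2) (XopLin m (f m m) v) := by
  have inner (s : ℤ × ℤ) : ∑ r ∈ nvars m v,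
        c s r • XopLin m (f s r) (DopLin m s (DopLin m r (XmZLin m j v))) =
      ∑ r ∈ nvars m v, c s r • XopLin m (f s r) (DopLin m s (XmZLin m j (DopLin m r v))) +
        ((j : ℂ) * c s m) • XopLin m (f s m) (DopLin m s (XmZLin m (j - 1) v)) := by
    conv_lhs => simp only [DopLin_XmZLin m _ j v, map_add, smul_add, Finset.sum_add_distrib]
    congr 1
    rw [Finset.sum_eq_single_of_mem m (mem_nvars_self m v)]
    · simp [smul_smul, mul_comm]
    · intro r _ hr
      simp [hr]
  have first : ∑ s ∈ nvars m v, ∑ r ∈ nvars m v,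
        c s r • XopLin m (f s r) (DopLin m s (XmZLin m j (DopLin m r v))) =
      XmZLin m j (∑ s ∈ nvars m v, ∑ r ∈ nvars m v,
        c s r • XopLin m (f s r) (DopLin m s (DopLin m r v))) +
      (j : ℂ) • XmZLin m (j - 1)
        (∑ r ∈ nvars m v, c m r • XopLin m (f m r) (DopLin m r v)) := by
    simp only [DopLin_XmZLin, map_add, smul_add, Finset.sum_add_distrib, map_sum, map_smul,
      XopLin_XmZLin]
    congr 1
    rw [Finset.sum_eq_single_of_mem m (mem_nvars_self m v)]
    · simp [XopLin_XmZLin, Finset.smul_sum, smul_comm (j : ℂ)]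
    · intro s _ hs
      simp [hs]
  simp only [inner, Finset.sum_add_distrib, first]
  rw [sum_Xop_Dop_XmZ m (fun s => (j : ℂ) * c s m) (fun s => f s m) (j - 1) v, ← add_assoc]
  congr 2
  · simp only [map_sum, map_smul, Finset.smul_sum, smul_smul]
  · push_cast
    ring
  · rw [sub_sub]
    rfl

theorem E11N_XmZ (q μ : ℂ) (m n : ℤ × ℤ) (j : ℤ) (v : NN m) :
    E11N q μ m n (XmZ m j v) = XmZ m j (E11N q μ m n v) -
      ((j : ℂ) * q ^ (m.2 * n.1)) • XmZ m (j - 1) (Xop m (n + m) v) := by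
  simp only [E11N, XmZ_eq_lin, Xop_eq_lin, Dop_eq_lin, nvars_XmZLin]
  rw [sum_Xop_Dop_XmZ m (fun s => q ^ (s.2 * n.1)) (fun s => n + s)]
  split_ifs <;> simp only [map_sub, map_smul, map_zero] <;> abel

theorem E22N_XmZ (q : ℂ) (m n : ℤ × ℤ) (j : ℤ) (v : NN m) :
    E22N q m n (XmZ m j v) = XmZ m j (E22N q m n v) +
      ((j : ℂ) * q ^ (m.1 * n.2)) • XmZ m (j - 1) (Xop m (n + m) v) := by
  simp only [E22N, XmZ_eq_lin, Xop_eq_lin, Dop_eq_lin, nvars_XmZLin]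
  exact sum_Xop_Dop_XmZ m (fun s => q ^ (s.1 * n.2)) (fun s => n + s) j v

theorem E12N_XmZ {q : ℂ} (hq : q ≠ 0) (μ : ℂ) (m n : ℤ × ℤ) (j : ℤ) (v : NN m) :
    E12N q μ m n (XmZ m j v) = XmZ m j (E12N q μ m n v) -
      (j : ℂ) • XmZ m (j - 1) (q ^ (m.2 * n.1) • E22N q m (m + n) v
        - q ^ (m.1 * n.2) • E11N q μ m (m + n) v) -
      ((j : ℂ) * (j - 1) * q ^ (m.2 * n.1 + m.2 * m.1 + m.1 * n.2)) •
        XmZ m (j - 2) (Xop m (m + m + n) v) := by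
  have h22 : q ^ (m.2 * n.1) • E22N q m (m + n) v = ∑ r ∈ nvars m v,
      q ^ (n.2 * r.1 + m.2 * n.1 + m.2 * r.1) • XopLin m (n + m + r) (DopLin m r v) := by
    simp only [E22N, Finset.smul_sum, smul_smul, ← zpow_add₀ hq, Xop_eq_lin, Dop_eq_lin]
    refine Finset.sum_congr rfl fun r _ => ?_
    rw [add_comm n m]
    congr 2
    simp only [Prod.snd_add]
    ring
  have h11 : q ^ (m.1 * n.2) • E11N q μ m (m + n) v =
      (if -n = m then (q ^ (-(n.1 * n.2)) * μ) • v else 0) - ∑ s ∈ nvars m v,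
        q ^ (n.2 * m.1 + s.2 * n.1 + s.2 * m.1) • XopLin m (n + s + m) (DopLin m s v) := by
    simp only [E11N, smul_sub, Finset.smul_sum, smul_smul, ← zpow_add₀ hq, Xop_eq_lin,
      Dop_eq_lin]
    congr 1
    · by_cases h : -n = m
      · subst h
        simp [smul_smul]
      · have h' : m + n ≠ 0 := fun h' => h (eq_neg_of_add_eq_zero_left h').symm
        simp [h, h']
    · refine Finset.sum_congr rfl fun s _ => ?_
      rw [add_right_comm n s m, add_comm n m]
      congr 2
      simp only [Prod.fst_add]
      ring
  rw [h22, h11]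
  simp only [E12N, XmZ_eq_lin, Xop_eq_lin, Dop_eq_lin, nvars_XmZLin]
  rw [sum_Xop_Dop_Dop_XmZ m (fun s r => q ^ (n.2 * r.1 + s.2 * n.1 + s.2 * r.1))
    (fun s r => n + s + r), DopLin_XmZLin]
  have hexp : n.2 * m.1 + m.2 * n.1 + m.2 * m.1 = m.2 * n.1 + m.2 * m.1 + m.1 * n.2 := by ring
  have hidx : n + m + m = m + m + n := by abel
  simp only [hexp, hidx]
  split_ifs <;> simp only [map_sub, map_smul, map_zero] <;> module

theorem D1N_XmZ (m : ℤ × ℤ) (j : ℤ) (v : NN m) :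
    D1N m (XmZ m j v) = XmZ m j (D1N m v) + ((j : ℂ) * m.1) • XmZ m j v := by
  simp only [D1N, XmZ_eq_lin, Xop_eq_lin, Dop_eq_lin, nvars_XmZLin]
  rw [sum_Xop_Dop_XmZ m (fun s => (s.1 : ℂ)) (fun s => s), XopLin_self, XmZLin_XmZLin,
    sub_add_cancel]

theorem D2N_XmZ (m : ℤ × ℤ) (j : ℤ) (v : NN m) :
    D2N m (XmZ m j v) = XmZ m j (D2N m v) + ((j : ℂ) * m.2) • XmZ m j v := by
  simp only [D2N, XmZ_eq_lin, Xop_eq_lin, Dop_eq_lin, nvars_XmZLin]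
  rw [sum_Xop_Dop_XmZ m (fun s => (s.2 : ℂ)) (fun s => s), XopLin_self, XmZLin_XmZLin,
    sub_add_cancel]

theorem XmZ_neg_one_XmZ (m : ℤ × ℤ) (k : ℤ) (v : NN m) :
    XmZ m (-1) (XmZ m k v) = XmZ m (k - 1) v := by
  rw [XmZ_eq_lin, XmZ_eq_lin, XmZLin_XmZLin, neg_add_eq_sub, ← XmZ_eq_lin]

theorem Xop_XmZ (m n : ℤ × ℤ) (j : ℤ) (g : NN m) :
    Xop m n (XmZ m j g) = XmZ m j (Xop m n g) :=
  XopLin_XmZLin m n j g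

theorem tE11_XmZ (q μ : ℂ) (m n : ℤ × ℤ) (k : ℤ) (v : NN m) :
    tE11 q μ m (k : ℂ) n (XmZ m k v) = XmZ m k (E11N q μ m n v) := by
  rw [tE11, E11N_XmZ, XmZ_neg_one_XmZ, Xop_XmZ, add_comm m n, sub_add_cancel]

theorem tE22_XmZ (q : ℂ) (m n : ℤ × ℤ) (k : ℤ) (v : NN m) :
    tE22 q m (k : ℂ) n (XmZ m k v) = XmZ m k (E22N q m n v) := by
  rw [tE22, E22N_XmZ, XmZ_neg_one_XmZ, Xop_XmZ, add_comm m n, add_sub_cancel_right]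

theorem tE12_XmZ {q : ℂ} (hq : q ≠ 0) (μ : ℂ) (m n : ℤ × ℤ) (k : ℤ) (v : NN m) :
    tE12 q μ m (k : ℂ) n (XmZ m k v) = XmZ m k (E12N q μ m n v) := by
  have hidx : m + n + m = m + m + n := by abel
  have hexp1 : q ^ (m.2 * n.1 + m.2 * m.1 + m.1 * n.2) =
      q ^ (m.2 * n.1) * q ^ (m.1 * (m + n).2) := by
    rw [← zpow_add₀ hq, Prod.snd_add]
    ring_nf
  have hexp2 : q ^ (m.2 * n.1 + m.2 * m.1 + m.1 * n.2) =
      q ^ (m.1 * n.2) * q ^ (m.2 * (m + n).1) := by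
    rw [← zpow_add₀ hq, Prod.fst_add]
    ring_nf
  rw [tE12, E12N_XmZ hq, XmZ_neg_one_XmZ, XmZ_neg_one_XmZ, E22N_XmZ, E11N_XmZ, hidx, Xop_XmZ,
    sub_sub k 1 1, one_add_one_eq_two]
  simp only [XmZ_eq_lin, map_sub, map_smul]
  match_scalars
  · ring
  · ring
  · ring
  · linear_combination (-(k : ℂ) * (k - 1)) * (hexp1 + hexp2)

theorem E21N_XmZ (m n : ℤ × ℤ) (k : ℤ) (v : NN m) :
    E21N m n (XmZ m k v) = XmZ m k (E21N m n v) :=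
  Xop_XmZ m n k v

theorem tD1_XmZ (m : ℤ × ℤ) (k : ℤ) (v : NN m) :
    tD1 m (k : ℂ) (XmZ m k v) = XmZ m k (D1N m v) := by
  rw [tD1, D1N_XmZ, add_sub_cancel_right]

theorem tD2_XmZ (m : ℤ × ℤ) (k : ℤ) (v : NN m) :
    tD2 m (k : ℂ) (XmZ m k v) = XmZ m k (D2N m v) := by
  rw [tD2, D2N_XmZ, add_sub_cancel_right]

/-- for `b = k ∈ ℤ`, each `b`-twisted generator equals
`X_m^k ∘ u ∘ X_m^{−k}` (here `Ẽ21(n) = E21(n)`), and consequently `v ↦ x_m^k v`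
intertwines the untwisted operators with the `b`-twisted ones,
i.e. `𝒟_m^b M ≅ 𝒟_m M`. -/
theorem stmt12 (q μ : ℂ) (hq : q ≠ 0) (m : ℤ × ℤ) (k : ℤ) :
    ((∀ (n : ℤ × ℤ) (g : NN m),
        tE11 q μ m (k : ℂ) n g = XmZ m k (E11N q μ m n (XmZ m (-k) g)) ∧
        tE12 q μ m (k : ℂ) n g = XmZ m k (E12N q μ m n (XmZ m (-k) g)) ∧
        E21N m n g = XmZ m k (E21N m n (XmZ m (-k) g)) ∧
        tE22 q m (k : ℂ) n g = XmZ m k (E22N q m n (XmZ m (-k) g))) ∧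
      (∀ g : NN m,
        tD1 m (k : ℂ) g = XmZ m k (D1N m (XmZ m (-k) g)) ∧
        tD2 m (k : ℂ) g = XmZ m k (D2N m (XmZ m (-k) g)))) ∧
    ((∀ (n : ℤ × ℤ) (v : NN m),
        tE11 q μ m (k : ℂ) n (XmZ m k v) = XmZ m k (E11N q μ m n v) ∧
        tE12 q μ m (k : ℂ) n (XmZ m k v) = XmZ m k (E12N q μ m n v) ∧
        E21N m n (XmZ m k v) = XmZ m k (E21N m n v) ∧
        tE22 q m (k : ℂ) n (XmZ m k v) = XmZ m k (E22N q m n v)) ∧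
      (∀ v : NN m,
        tD1 m (k : ℂ) (XmZ m k v) = XmZ m k (D1N m v) ∧
        tD2 m (k : ℂ) (XmZ m k v) = XmZ m k (D2N m v))) := by
  have main : (∀ (n : ℤ × ℤ) (v : NN m),
        tE11 q μ m (k : ℂ) n (XmZ m k v) = XmZ m k (E11N q μ m n v) ∧
        tE12 q μ m (k : ℂ) n (XmZ m k v) = XmZ m k (E12N q μ m n v) ∧
        E21N m n (XmZ m k v) = XmZ m k (E21N m n v) ∧
        tE22 q m (k : ℂ) n (XmZ m k v) = XmZ m k (E22N q m n v)) ∧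
      (∀ v : NN m,
        tD1 m (k : ℂ) (XmZ m k v) = XmZ m k (D1N m v) ∧
        tD2 m (k : ℂ) (XmZ m k v) = XmZ m k (D2N m v)) :=
    ⟨fun n v => ⟨tE11_XmZ q μ m n k v, tE12_XmZ hq μ m n k v, E21N_XmZ m n k v,
      tE22_XmZ q m n k v⟩, fun v => ⟨tD1_XmZ m k v, tD2_XmZ m k v⟩⟩
  refine ⟨⟨fun n g => ?_, fun g => ?_⟩, main⟩
  · simpa only [XmZ_XmZ_neg] using main.1 n (XmZ m (-k) g)
  · simpa only [XmZ_XmZ_neg] using main.2 (XmZ m (-k) g)
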